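/- arXiv:1503.04314 — 2 statements merged into one kernel-verified Lean document; each statement's English description precedes it below -/
import Mathlib

section
/- Let t1 < t2 be reals, λ∞ ∈ ℂ with Im λ∞ ≥ 0, d ∈ ℝ, and let σ be a nonzero finite Borel measure on ℝ whose support is an infinite subset of [t1,t2]. Then there exist a0 ∈ ℝ, b0 > 0, reals t3 < t4, and a Borel probability measure μ whose support is an infinite subset of [t3,t4], such that for every z ∈ ℂ with Im z > 0: (z − λ∞)(z − conj(λ∞)) = −(a0 − z + b0² ∫ dμ(t)/(t−z)) · (z + d + ∫ dσ(t)/(t−z)). (This is the direction (i) ⇒ (ii) of Theorem 1: a function of the form m(z) = (z + d + ∫ dσ(t)/(t−z))/((z−λ∞)(z−conj λ∞)) also admits the representation −1/m(z) = a0 − z + b0² ∫ dμ(t)/(t−z).) -/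
open MeasureTheory Complex Filter

/-- Cauchy transform of a Borel measure on ℝ, at a point `z` (defined off the support). -/
noncomputable def cauchyT (σ : Measure ℝ) (z : ℂ) : ℂ := ∫ t, ((t : ℂ) - z)⁻¹ ∂σ

/-- Topological support of a Borel measure on ℝ. -/
def msupport (σ : Measure ℝ) : Set ℝ := {x | ∀ U ∈ nhds x, σ U ≠ 0}

open scoped InnerProductSpace in
/-- The spectral measure of a bounded self-adjoint operator at a vector. -/
theorem exists_spectralMeasure {H : Type*} [NormedAddCommGroup H] [InnerProductSpace ℂ H]
    [CompleteSpace H] {A : H →L[ℂ] H} (hA : IsSelfAdjoint A) (e : H) :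
    ∃ (ρ : Measure ℝ) (R : ℝ), IsFiniteMeasure ρ ∧ 0 < R ∧ ρ (Set.Icc (-R) R)ᶜ = 0 ∧
      ∀ g : ℝ → ℝ, Continuous g → ⟪e, cfc g A e⟫_ℂ = ((∫ t, g t ∂ρ : ℝ) : ℂ) := by
  let Φ : C(spectrum ℝ A, ℝ) →⋆ₐ[ℝ] (H →L[ℂ] H) := cfcHom hA
  let Λ₀ : CompactlySupportedContinuousMap (spectrum ℝ A) ℝ →ₗ[ℝ] ℝ :=
    { toFun := fun f => (⟪e, Φ f.toContinuousMap e⟫_ℂ).re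
      map_add' := fun f g => by
        have : (f + g).toContinuousMap = f.toContinuousMap + g.toContinuousMap := rfl
        simp [this]
      map_smul' := fun c f => by
        have : (c • f).toContinuousMap = c • f.toContinuousMap := rfl
        simp only [this, map_smul, smul_apply]
        rw [← Complex.coe_smul, inner_smul_right]
        simp }
  let Λ : CompactlySupportedContinuousMap (spectrum ℝ A) ℝ →ₚ[ℝ] ℝ :=
    PositiveLinearMap.mk₀ Λ₀ fun f hf => by
      have h : 0 ≤ Φ f.toContinuousMap := (cfcHom_nonneg_iff hA).2 hf
      exact ((ContinuousLinearMap.nonneg_iff_isPositive _).1 h).re_inner_nonneg_right e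
  let ν : Measure (spectrum ℝ A) := RealRMK.rieszMeasure Λ
  have hν : IsFiniteMeasure ν := by
    have : ν.Regular := by unfold ν; infer_instance
    infer_instance
  have hme : MeasurableEmbedding (Subtype.val : spectrum ℝ A → ℝ) :=
    MeasurableEmbedding.subtype_coe (spectrum.isClosed A).measurableSet
  obtain ⟨R, hR, hsub⟩ := (spectrum.isBounded (𝕜 := ℝ) A).subset_closedBall_lt 0 0
  refine ⟨ν.map Subtype.val, R, inferInstance, hR, ?_, fun g hg => ?_⟩
  · rw [hme.map_apply]
    convert measure_empty (μ := ν)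
    ext x
    have := hsub x.2
    rw [Real.closedBall_eq_Icc] at this
    simpa using this
  · rw [hme.integral_map]
    let f : C(spectrum ℝ A, ℝ) := ⟨fun x => g x, hg.comp continuous_subtype_val⟩
    have h1 : ∫ x, g x ∂ν = Λ (CompactlySupportedContinuousMap.continuousMapEquiv f) :=
      RealRMK.integral_rieszMeasure Λ (CompactlySupportedContinuousMap.continuousMapEquiv f)
    have h2 : cfc g A = Φ f := cfc_apply g A hA hg.continuousOn
    have h3 : Λ (CompactlySupportedContinuousMap.continuousMapEquiv f) = (⟪e, Φ f e⟫_ℂ).re := rfl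
    rw [h1, h3, h2]
    have h4 : IsSelfAdjoint (Φ f) := cfcHom_predicate hA f
    exact ((ContinuousLinearMap.isSelfAdjoint_iff_isSymmetric.1 h4).coe_re_inner_self_apply e).symm

theorem integrable_of_continuous_of_compl_Icc {E : Type*} [NormedAddCommGroup E] {ρ : Measure ℝ}
    [IsFiniteMeasure ρ] {a b : ℝ} (hρ : ρ (Set.Icc a b)ᶜ = 0) {g : ℝ → E} (hg : Continuous g) :
    Integrable g ρ := by
  have h : ρ.restrict (Set.Icc a b) = ρ := Measure.restrict_eq_self_of_ae_mem (mem_ae_iff.2 hρ)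
  rw [← h]
  exact hg.integrableOn_Icc

theorem cfc_mul_sub_algebraMap {H : Type*} [NormedAddCommGroup H] [InnerProductSpace ℂ H]
    [CompleteSpace H] {A : H →L[ℂ] H} (hA : IsSelfAdjoint A) {z : ℂ} (hz : z.im ≠ 0) :
    (cfc (fun t => (t - z.re) * ((t - z.re) ^ 2 + z.im ^ 2)⁻¹) A +
      (z.im * I) • cfc (fun t => ((t - z.re) ^ 2 + z.im ^ 2)⁻¹) A) *
        (A - algebraMap ℂ _ z) = 1 := by
  have hne : ∀ t : ℝ, (t - z.re) ^ 2 + z.im ^ 2 ≠ 0 := fun t => by positivity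
  set r : ℝ → ℝ := fun t => ((t - z.re) ^ 2 + z.im ^ 2)⁻¹ with hrdef
  have hr : Continuous r := by fun_prop (disch := exact hne _)
  set r₁ : ℝ → ℝ := fun t => (t - z.re) * r t with hr1def
  have hr1 : Continuous r₁ := by fun_prop
  have h1 : A - algebraMap ℂ _ z = cfc (fun t => t - z.re) A - (z.im * I) • 1 := by
    rw [cfc_sub _ _ A (by fun_prop) (by fun_prop), cfc_id' ℝ A, cfc_const z.re A,
      Algebra.algebraMap_eq_smul_one, Algebra.algebraMap_eq_smul_one, ← Complex.coe_smul]
    conv_lhs => rw [← Complex.re_add_im z]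
    rw [add_smul]
    abel
  have h2 : cfc r₁ A = cfc r A * cfc (fun t => t - z.re) A := by
    rw [← cfc_mul _ _ A (by fun_prop) (by fun_prop)]
    congr 1
    ext t
    exact mul_comm _ _
  have h3 : cfc r₁ A * cfc (fun t => t - z.re) A + ((z.im : ℂ) ^ 2) • cfc r A = 1 := by
    rw [← cfc_mul _ _ A (by fun_prop) (by fun_prop), ← Complex.ofReal_pow, Complex.coe_smul,
      ← cfc_const_mul _ _ A (by fun_prop), ← cfc_add _ _ _ (by fun_prop) (by fun_prop),
      ← cfc_const_one ℝ A]
    congr 1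
    ext t
    rw [← mul_inv_cancel₀ (hne t)]
    simp only [hr1def, hrdef]
    ring
  rw [h1, mul_sub, add_mul, smul_mul_assoc, ← h2, mul_smul_comm, mul_one, ← h3, smul_add,
    smul_smul]
  have h4 : (z.im * I) * (z.im * I) = -(z.im : ℂ) ^ 2 := by
    linear_combination (z.im : ℂ) ^ 2 * I_sq
  rw [h4, neg_smul]
  abel

section BlockOperator

open scoped InnerProductSpace

variable {K : Type*} [NormedAddCommGroup K] [InnerProductSpace ℂ K]

/-- The operator `(x, f) ↦ (-d x + ⟪w, f⟫, x w + T f)` on `ℂ ⊕ K`. -/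
noncomputable def blockOp (T : K →L[ℂ] K) (w : K) (d : ℝ) :
    WithLp 2 (ℂ × K) →L[ℂ] WithLp 2 (ℂ × K) :=
  ((WithLp.prodContinuousLinearEquiv 2 ℂ ℂ K).symm : ℂ × K →L[ℂ] WithLp 2 (ℂ × K)) ∘L
    ((-(d : ℂ)) • ContinuousLinearMap.fst ℂ ℂ K + innerSL ℂ w ∘L ContinuousLinearMap.snd ℂ ℂ K).prod
      ((ContinuousLinearMap.fst ℂ ℂ K).smulRight w + T ∘L ContinuousLinearMap.snd ℂ ℂ K) ∘L
    ((WithLp.prodContinuousLinearEquiv 2 ℂ ℂ K) : WithLp 2 (ℂ × K) →L[ℂ] ℂ × K)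

theorem blockOp_apply (T : K →L[ℂ] K) (w : K) (d : ℝ) (x : ℂ) (f : K) :
    blockOp T w d (WithLp.toLp 2 (x, f)) = WithLp.toLp 2 (-d * x + ⟪w, f⟫_ℂ, x • w + T f) := by
  simp [blockOp]

theorem exists_monic_aeval_blockOp (T : K →L[ℂ] K) (w : K) (d : ℝ) {F : Finset ℝ}
    (hF : F.Nonempty) :
    ∃ (c : ℂ) (r : Polynomial ℂ), r.Monic ∧
      Polynomial.aeval (blockOp T w d) (∏ a ∈ F, (Polynomial.X - Polynomial.C a))
        (WithLp.toLp 2 (1, 0)) = WithLp.toLp 2 (c, Polynomial.aeval T r w) := by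
  have key : ∀ (a : ℝ) (x : ℂ) (f : K), (blockOp T w d - algebraMap ℝ _ a) (WithLp.toLp 2 (x, f)) =
      WithLp.toLp 2 (-d * x + ⟪w, f⟫_ℂ - a * x, x • w + T f - (a : ℂ) • f) := by
    intro a x f
    rw [sub_apply, blockOp_apply, Algebra.algebraMap_eq_smul_one]
    rw [smul_apply, one_apply_eq_self, ← Complex.coe_smul]
    rfl
  induction hF using Finset.Nonempty.cons_induction with
  | singleton a =>
    refine ⟨-d * 1 + ⟪w, 0⟫_ℂ - a * 1, 1, Polynomial.monic_one, ?_⟩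
    rw [Finset.prod_singleton, map_sub, Polynomial.aeval_X, Polynomial.aeval_C, key]
    simp
  | cons a s ha hs ih =>
    obtain ⟨c, r, hr, h⟩ := ih
    refine ⟨-d * c + ⟪w, Polynomial.aeval T r w⟫_ℂ - a * c,
      (Polynomial.X - Polynomial.C (a : ℂ)) * r + Polynomial.C c, ?_, ?_⟩
    rotate_left
    · rw [Finset.prod_cons, map_mul, mul_apply_eq_comp, h, map_sub, Polynomial.aeval_X,
        Polynomial.aeval_C, key]
      congr 2
      simp only [map_add, map_mul, map_sub, Polynomial.aeval_X, Polynomial.aeval_C,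
        mul_apply_eq_comp, Algebra.algebraMap_eq_smul_one, add_apply,
        sub_apply, smul_apply, one_apply_eq_self]
      abel
    · refine ((Polynomial.monic_X_sub_C (a : ℂ)).mul hr).add_of_left ?_
      refine Polynomial.degree_C_le.trans_lt ?_
      rw [Polynomial.degree_mul, Polynomial.degree_X_sub_C, Polynomial.degree_eq_natDegree hr.ne_zero]
      norm_cast
      omega

variable [CompleteSpace K]

theorem isSelfAdjoint_blockOp {T : K →L[ℂ] K} (hT : IsSelfAdjoint T) (w : K) (d : ℝ) :
    IsSelfAdjoint (blockOp T w d) := by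
  rw [ContinuousLinearMap.isSelfAdjoint_iff_isSymmetric]
  rintro ⟨x, f⟩ ⟨y, g⟩
  have h : ⟪T f, g⟫_ℂ = ⟪f, T g⟫_ℂ :=
    ContinuousLinearMap.isSelfAdjoint_iff_isSymmetric.1 hT f g
  simp only [ContinuousLinearMap.coe_coe, blockOp_apply, WithLp.prod_inner_apply, inner_add_left,
    inner_add_right, inner_smul_left, inner_smul_right, h, RCLike.inner_apply, map_add, map_mul,
    inner_conj_symm, map_neg, Complex.conj_ofReal]
  ring

theorem exists_measure_cauchyT_blockOp {T : K →L[ℂ] K} (hT : IsSelfAdjoint T) (w : K) (d : ℝ) :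
    ∃ (ρ : Measure ℝ) (R : ℝ), IsProbabilityMeasure ρ ∧ 0 < R ∧ ρ (Set.Icc (-R) R)ᶜ = 0 ∧
      (∀ (z : ℂ) (u : K), 0 < z.im → T u - z • u = -w →
        cauchyT ρ z * (-d - z + ⟪w, u⟫_ℂ) = 1) ∧
      ∀ F : Finset ℝ, ρ (F : Set ℝ)ᶜ = 0 → ∃ r : Polynomial ℂ, r.Monic ∧
        Polynomial.aeval T r w = 0 := by
  set A := blockOp T w d with hAdef
  have hA : IsSelfAdjoint A := isSelfAdjoint_blockOp hT w d
  set e : WithLp 2 (ℂ × K) := WithLp.toLp 2 (1, 0) with he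
  obtain ⟨ρ, R, hfin, hR, hρ, hcfc⟩ := exists_spectralMeasure hA e
  have hprob : IsProbabilityMeasure ρ := by
    have h := hcfc (fun _ => 1) continuous_const
    rw [cfc_const_one ℝ A] at h
    simp [he] at h
    have h1 : ρ.real Set.univ = 1 := by exact_mod_cast h.symm
    exact ⟨by rwa [Measure.real, ENNReal.toReal_eq_one_iff] at h1⟩
  refine ⟨ρ, R, hprob, hR, hρ, fun z u hz hu => ?_, fun F hF => ?_⟩
  · have hne : ∀ t : ℝ, (t - z.re) ^ 2 + z.im ^ 2 ≠ 0 := fun t => by positivity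
    set r : ℝ → ℝ := fun t => ((t - z.re) ^ 2 + z.im ^ 2)⁻¹ with hrdef
    have hr : Continuous r := by fun_prop (disch := exact hne _)
    set r₁ : ℝ → ℝ := fun t => (t - z.re) * r t with hr1def
    have hr1 : Continuous r₁ := by fun_prop
    set L := cfc r₁ A + (z.im * I) • cfc r A with hL
    have hLe : ⟪e, L e⟫_ℂ = cauchyT ρ z := by
      have hi : ∀ g : ℝ → ℝ, Continuous g → Integrable g ρ := fun g hg =>
        integrable_of_continuous_of_compl_Icc hρ hg
      rw [hL, add_apply, smul_apply, inner_add_right, inner_smul_right, hcfc _ hr1, hcfc _ hr,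
        cauchyT, ← integral_complex_ofReal, ← integral_complex_ofReal, ← integral_const_mul,
        ← integral_add (hi _ hr1).ofReal ((hi _ hr).ofReal.const_mul _)]
      congr 1
      ext t
      rw [eq_comm, inv_eq_iff_eq_inv, eq_comm]
      apply inv_eq_of_mul_eq_one_left
      have h1 : (r t : ℂ) * ((t - z.re) ^ 2 + z.im ^ 2) = 1 := by
        norm_cast
        exact inv_mul_cancel₀ (hne t)
      rw [hr1def]
      push_cast
      have h2 : (t : ℂ) - z = (t - z.re) - z.im * I := by
        conv_lhs => rw [← Complex.re_add_im z]
        ring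
      rw [h2]
      linear_combination h1 - (z.im : ℂ) ^ 2 * r t * I_sq
    have hLA : L * (A - algebraMap ℂ _ z) = 1 := cfc_mul_sub_algebraMap hA hz.ne'
    have hAu : (A - algebraMap ℂ _ z) (WithLp.toLp 2 (1, u)) = (-d - z + ⟪w, u⟫_ℂ) • e := by
      have hsnd : (1 : ℂ) • w + T u - z • u = 0 := by
        rw [one_smul, add_sub_assoc, hu, add_neg_cancel]
      rw [sub_apply, hAdef, blockOp_apply, Algebra.algebraMap_eq_smul_one, smul_apply,
        one_apply_eq_self, ← WithLp.toLp_smul, ← WithLp.toLp_sub, he, ← WithLp.toLp_smul]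
      simp only [Prod.smul_mk, Prod.mk_sub_mk, hsnd, smul_zero, smul_eq_mul, mul_one]
      congr 2
      ring
    have h := congrArg (fun B => ⟪e, B (WithLp.toLp 2 (1, u))⟫_ℂ) hLA
    simp only [mul_apply_eq_comp, hAu, map_smul, inner_smul_right, hLe] at h
    rw [mul_comm, h]
    simp [he, WithLp.prod_inner_apply]
  · have hne : F.Nonempty := by
      rw [Finset.nonempty_iff_ne_empty]
      rintro rfl
      simp at hF
    obtain ⟨c, r, hr, h⟩ := exists_monic_aeval_blockOp T w d hne
    refine ⟨r, hr, ?_⟩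
    set Q : Polynomial ℝ := ∏ a ∈ F, (Polynomial.X - Polynomial.C a) with hQ
    have h1 := hcfc (fun t => Q.eval t * Q.eval t) (by fun_prop)
    rw [cfc_mul _ _ A (by fun_prop) (by fun_prop), cfc_polynomial Q A] at h1
    have h2 : ∫ t, Q.eval t * Q.eval t ∂ρ = 0 := by
      apply integral_eq_zero_of_ae
      filter_upwards [mem_ae_iff.2 hF] with t ht
      have : Q.eval t = 0 := by
        rw [hQ, Polynomial.eval_prod]
        exact Finset.prod_eq_zero ht (by simp)
      simp [this]
    have h3 : IsSelfAdjoint (Polynomial.aeval A Q) := by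
      rw [← cfc_polynomial Q A]
      exact cfc_predicate _ A
    have h4 := ContinuousLinearMap.isSelfAdjoint_iff_isSymmetric.1 h3 e (Polynomial.aeval A Q e)
    rw [h2, mul_apply_eq_comp] at h1
    simp only [ContinuousLinearMap.coe_coe] at h4
    rw [h1, Complex.ofReal_zero, inner_self_eq_zero, h] at h4
    exact congrArg (fun v => v.ofLp.2) h4

end BlockOperator

theorem msupport_eq_support (σ : Measure ℝ) : msupport σ = σ.support := by
  ext x
  simp [msupport, Measure.mem_support_iff_forall, pos_iff_ne_zero]

theorem msupport_subset_of_isClosed {σ : Measure ℝ} {C : Set ℝ} (hC : IsClosed C)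
    (h : σ Cᶜ = 0) : msupport σ ⊆ C := by
  rw [msupport_eq_support]
  exact Measure.support_subset_of_isClosed hC (mem_ae_iff.2 h)

theorem measure_compl_eq_zero_of_msupport_subset {σ : Measure ℝ} {C : Set ℝ}
    (h : msupport σ ⊆ C) : σ Cᶜ = 0 := by
  rw [msupport_eq_support] at h
  exact measure_mono_null (Set.compl_subset_compl.2 h) Measure.measure_compl_support

theorem ofReal_sub_ne_zero {z : ℂ} (hz : 0 < z.im) (t : ℝ) : (t : ℂ) - z ≠ 0 := fun h => by
  have := congrArg Complex.im h
  simp at this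
  exact hz.ne' this

theorem norm_inv_ofReal_sub_le {z : ℂ} (hz : 0 < z.im) (t : ℝ) : ‖((t : ℂ) - z)⁻¹‖ ≤ z.im⁻¹ := by
  rw [norm_inv]
  refine inv_anti₀ hz ?_
  have := Complex.abs_im_le_norm ((t : ℂ) - z)
  simpa [abs_of_pos hz] using this

section MulOp

open scoped InnerProductSpace ENNReal

variable {σ : Measure ℝ}

/-- Multiplication by the independent variable on `L²(σ)`, for compactly supported `σ`. -/
theorem exists_mulOp {R : ℝ} (hσ : ∀ᵐ t ∂σ, |t| ≤ R) :
    ∃ T : Lp ℂ 2 σ →L[ℂ] Lp ℂ 2 σ, ∀ f : Lp ℂ 2 σ, T f =ᵐ[σ] fun t => (t : ℂ) * f t := by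
  have hτ : MemLp (fun t : ℝ => (t : ℂ)) ∞ σ :=
    memLp_top_of_bound (by fun_prop) R (by simpa using hσ)
  refine ⟨(ContinuousLinearMap.mul ℂ ℂ).holderL σ ∞ 2 2 hτ.toLp, fun f => ?_⟩
  filter_upwards [(ContinuousLinearMap.mul ℂ ℂ).coeFn_holder (r := 2) hτ.toLp f, hτ.coeFn_toLp]
    with t h1 h2
  refine h1.trans ?_
  rw [h2]
  rfl

theorem isSelfAdjoint_of_mulOp {T : Lp ℂ 2 σ →L[ℂ] Lp ℂ 2 σ}
    (hT : ∀ f : Lp ℂ 2 σ, T f =ᵐ[σ] fun t => (t : ℂ) * f t) : IsSelfAdjoint T := by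
  rw [ContinuousLinearMap.isSelfAdjoint_iff_isSymmetric]
  intro f g
  simp only [ContinuousLinearMap.coe_coe, L2.inner_def]
  apply integral_congr_ae
  filter_upwards [hT f, hT g] with t h1 h2
  rw [h1, h2]
  simp only [RCLike.inner_apply, map_mul, Complex.conj_ofReal]
  ring

theorem aeval_mulOp {T : Lp ℂ 2 σ →L[ℂ] Lp ℂ 2 σ}
    (hT : ∀ f : Lp ℂ 2 σ, T f =ᵐ[σ] fun t => (t : ℂ) * f t) (r : Polynomial ℂ) (f : Lp ℂ 2 σ) :
    Polynomial.aeval T r f =ᵐ[σ] fun t => r.eval (t : ℂ) * f t := by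
  induction r using Polynomial.induction_on' with
  | add p q hp hq =>
    rw [map_add, add_apply]
    filter_upwards [Lp.coeFn_add (Polynomial.aeval T p f) (Polynomial.aeval T q f), hp, hq]
      with t h1 h2 h3
    rw [h1, Pi.add_apply, h2, h3, Polynomial.eval_add, add_mul]
  | monomial n a =>
    induction n with
    | zero =>
      simp only [Polynomial.monomial_zero_left, Polynomial.aeval_C, Polynomial.eval_C,
        Algebra.algebraMap_eq_smul_one, smul_apply, one_apply_eq_self]
      filter_upwards [Lp.coeFn_smul a f] with t h
      rw [h, Pi.smul_apply, smul_eq_mul]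
    | succ n ih =>
      rw [← Polynomial.X_mul_monomial, map_mul, Polynomial.aeval_X, mul_apply_eq_comp]
      filter_upwards [hT (Polynomial.aeval T (Polynomial.monomial n a) f), ih] with t h1 h2
      rw [h1, h2, Polynomial.eval_mul, Polynomial.eval_X, mul_assoc]

/-- The function `-1 / (z + d + cauchyT σ z)` is the Cauchy transform of a compactly
supported probability measure, which is not finitely supported. -/
theorem exists_cauchyT_mul_eq_neg_one [IsFiniteMeasure σ] {R : ℝ} (hσ : ∀ᵐ t ∂σ, |t| ≤ R)
    (hinf : (msupport σ).Infinite) (d : ℝ) :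
    ∃ (ρ : Measure ℝ) (R : ℝ), IsProbabilityMeasure ρ ∧ 0 < R ∧ ρ (Set.Icc (-R) R)ᶜ = 0 ∧
      (∀ z : ℂ, 0 < z.im → cauchyT ρ z * (z + d + cauchyT σ z) = -1) ∧
      ∀ F : Set ℝ, F.Finite → ρ Fᶜ ≠ 0 := by
  obtain ⟨T, hT⟩ := exists_mulOp hσ
  have hw : MemLp (fun _ : ℝ => (1 : ℂ)) 2 σ := memLp_const 1
  obtain ⟨ρ, R', hprob, hR', hρ, hz, hF⟩ :=
    exists_measure_cauchyT_blockOp (isSelfAdjoint_of_mulOp hT) hw.toLp d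
  refine ⟨ρ, R', hprob, hR', hρ, fun z hzim => ?_, fun F hFfin hF0 => ?_⟩
  · have hu : MemLp (fun t : ℝ => -((t : ℂ) - z)⁻¹) 2 σ := by
      refine MemLp.of_bound (Continuous.aestronglyMeasurable ?_) z.im⁻¹ (ae_of_all _ fun t => ?_)
      · fun_prop (disch := exact ofReal_sub_ne_zero hzim)
      · rw [norm_neg]
        exact norm_inv_ofReal_sub_le hzim t
    have h1 : T hu.toLp - z • hu.toLp = -hw.toLp := by
      apply Lp.ext
      filter_upwards [Lp.coeFn_sub (T hu.toLp) (z • hu.toLp), hT hu.toLp,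
        Lp.coeFn_smul z hu.toLp, Lp.coeFn_neg hw.toLp, hu.coeFn_toLp, hw.coeFn_toLp]
        with t h1 h2 h3 h4 h5 h6
      rw [h1, Pi.sub_apply, h2, h3, h4, Pi.smul_apply, Pi.neg_apply, h5, h6, smul_eq_mul]
      have := mul_inv_cancel₀ (ofReal_sub_ne_zero hzim t)
      linear_combination -this
    have h2 : ⟪hw.toLp, hu.toLp⟫_ℂ = -cauchyT σ z := by
      rw [L2.inner_def, cauchyT, ← integral_neg]
      apply integral_congr_ae
      filter_upwards [hu.coeFn_toLp, hw.coeFn_toLp] with t h3 h4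
      rw [h3, h4]
      simp
    have h3 := hz z hu.toLp hzim h1
    rw [h2] at h3
    linear_combination -h3
  · obtain ⟨r, hr, h0⟩ := hF hFfin.toFinset (by rwa [hFfin.coe_toFinset])
    have h1 : ∀ᵐ t : ℝ ∂σ, r.eval (t : ℂ) = 0 := by
      filter_upwards [aeval_mulOp hT r hw.toLp, hw.coeFn_toLp, Lp.coeFn_zero ℂ 2 σ]
        with t h1 h2 h3
      rw [h0, h3, h2] at h1
      simpa using h1.symm
    have hfin : {t : ℝ | r.eval (t : ℂ) = 0}.Finite := by
      have : ((fun t : ℝ => (t : ℂ)) ⁻¹' (r.rootSet ℂ)).Finite :=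
        (r.rootSet_finite ℂ).preimage Complex.ofReal_injective.injOn
      refine this.subset fun t ht => ?_
      simpa [Polynomial.mem_rootSet, hr.ne_zero] using ht
    exact hinf (hfin.subset (msupport_subset_of_isClosed hfin.isClosed h1))

end MulOp

theorem sub_mul_cauchyT {ρ : Measure ℝ} [IsProbabilityMeasure ρ] {R : ℝ}
    (hρ : ρ (Set.Icc (-R) R)ᶜ = 0) (l : ℂ) {z : ℂ} (hz : 0 < z.im) :
    (z - l) * (z - (starRingEnd ℂ) l) * cauchyT ρ z =
      ((2 * l.re - ∫ t, t ∂ρ : ℝ) : ℂ) - z +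
        ∫ t : ℝ, ((Complex.normSq (t - l) : ℝ) : ℂ) * ((t : ℂ) - z)⁻¹ ∂ρ := by
  have hne := ofReal_sub_ne_zero hz
  have hint : ∀ g : ℝ → ℂ, Continuous g → Integrable g ρ := fun g hg =>
    integrable_of_continuous_of_compl_Icc hρ hg
  have h1 : (((2 * l.re - ∫ t, t ∂ρ : ℝ) : ℂ) - z) = ∫ t : ℝ, ((2 * l.re - z) - (t : ℂ)) ∂ρ := by
    rw [integral_sub (hint _ (by fun_prop)) (hint _ (by fun_prop)), integral_complex_ofReal]
    simp
    ring
  have hc : Continuous fun t : ℝ => ((Complex.normSq (t - l) : ℝ) : ℂ) * ((t : ℂ) - z)⁻¹ := by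
    have : Continuous fun t : ℝ => Complex.normSq (t - l) :=
      Complex.continuous_normSq.comp (by fun_prop)
    fun_prop (disch := exact hne _)
  rw [h1, ← integral_add (hint _ (by fun_prop)) (hint _ hc), cauchyT, ← integral_const_mul]
  congr 1
  ext t
  have hl : l + (starRingEnd ℂ) l = 2 * l.re := by
    rw [Complex.add_conj]; push_cast; ring
  rw [Complex.normSq_eq_conj_mul_self, map_sub, Complex.conj_ofReal, ← hl]
  field_simp [hne t]
  ring

/-- Theorem 1, direction (i) ⇒ (ii). -/
theorem stmt_0 (t1 t2 : ℝ) (ht : t1 < t2) (lamInf : ℂ) (hlam : 0 ≤ lamInf.im)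
    (d : ℝ) (σ : Measure ℝ) (hfin : IsFiniteMeasure σ) (hσ0 : σ ≠ 0)
    (hσsupp : msupport σ ⊆ Set.Icc t1 t2) (hσinf : (msupport σ).Infinite) :
    ∃ (a0 b0 t3 t4 : ℝ) (μ : Measure ℝ), 0 < b0 ∧ t3 < t4 ∧
      IsProbabilityMeasure μ ∧ msupport μ ⊆ Set.Icc t3 t4 ∧ (msupport μ).Infinite ∧
      ∀ z : ℂ, 0 < z.im →
        (z - lamInf) * (z - (starRingEnd ℂ) lamInf) =
          -(((a0 : ℂ) - z + (b0 : ℂ) ^ 2 * cauchyT μ z) * (z + (d : ℂ) + cauchyT σ z)) := by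
  have hbdd : ∀ᵐ t ∂σ, |t| ≤ max |t1| |t2| := by
    filter_upwards [mem_ae_iff.2 (measure_compl_eq_zero_of_msupport_subset hσsupp)] with t h
    exact abs_le_max_abs_abs h.1 h.2
  obtain ⟨ρ, R, hprob, hR, hρ, hmul, hnotfin⟩ := exists_cauchyT_mul_eq_neg_one hbdd hσinf d
  set p : ℝ → ℝ := fun t => Complex.normSq (t - lamInf) with hp
  have hpc : Continuous p := Complex.continuous_normSq.comp (by fun_prop)
  have hp0 : ∀ t, 0 ≤ p t := fun t => Complex.normSq_nonneg _
  have hpz : {t | p t = 0} ⊆ {lamInf.re} := fun t h => by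
    have : (t : ℂ) - lamInf = 0 := Complex.normSq_eq_zero.1 h
    simpa [sub_eq_zero] using congrArg Complex.re this
  have hpi : Integrable p ρ := integrable_of_continuous_of_compl_Icc hρ hpc
  set s : ℝ := ∫ t, p t ∂ρ with hs
  have hspos : 0 < s := by
    refine (integral_nonneg hp0).lt_of_ne' fun h => ?_
    have h1 := (integral_eq_zero_iff_of_nonneg hp0 hpi).1 h
    refine hnotfin {lamInf.re} (Set.finite_singleton _) ?_
    exact measure_mono_null (Set.compl_subset_compl.2 hpz) (mem_ae_iff.1 h1)
  have hm : Measurable fun t => ENNReal.ofReal (p t / s) :=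
    (hpc.measurable.div_const s).ennreal_ofReal
  set μ : Measure ℝ := ρ.withDensity fun t => ENNReal.ofReal (p t / s) with hμ
  have hμρ : μ ≪ ρ := withDensity_absolutelyContinuous _ _
  refine ⟨2 * lamInf.re - ∫ t, t ∂ρ, √s, -R, R, μ, Real.sqrt_pos.2 hspos, by linarith, ⟨?_⟩,
    msupport_subset_of_isClosed isClosed_Icc (hμρ hρ), fun hf => ?_, fun z hz => ?_⟩
  · rw [hμ, withDensity_apply _ MeasurableSet.univ, Measure.restrict_univ,
      ← ofReal_integral_eq_lintegral_ofReal (hpi.div_const s)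
        (ae_of_all _ fun t => div_nonneg (hp0 t) hspos.le),
      integral_div, div_self hspos.ne', ENNReal.ofReal_one]
  · refine hnotfin (msupport μ ∪ {lamInf.re}) (hf.union (Set.finite_singleton _)) ?_
    have h1 : μ (msupport μ)ᶜ = 0 := measure_compl_eq_zero_of_msupport_subset subset_rfl
    rw [hμ, withDensity_apply_eq_zero hm] at h1
    refine measure_mono_null (fun t ht => ?_) h1
    rw [Set.mem_compl_iff, Set.mem_union, not_or] at ht
    refine ⟨?_, ht.1⟩
    have hpt : 0 < p t := (hp0 t).lt_of_ne' fun h => ht.2 (hpz h)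
    exact (ENNReal.ofReal_pos.2 (div_pos hpt hspos)).ne'
  · have h1 : ((√s : ℝ) : ℂ) ^ 2 * cauchyT μ z = ∫ t : ℝ, (p t : ℂ) * ((t : ℂ) - z)⁻¹ ∂ρ := by
      rw [cauchyT, hμ, integral_withDensity_eq_integral_toReal_smul hm (by simp),
        ← Complex.ofReal_pow, Real.sq_sqrt hspos.le, ← integral_const_mul]
      congr 1
      ext t
      rw [ENNReal.toReal_ofReal (div_nonneg (hp0 t) hspos.le), Complex.real_smul]
      have : (s : ℂ) ≠ 0 := by exact_mod_cast hspos.ne'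
      push_cast
      field_simp
    rw [h1, ← sub_mul_cauchyT hρ lamInf hz, mul_assoc, hmul z hz]
    ring
end

section
/- Proposition 3 (locally uniform convergence of the truncated m-functions): the sequence of functions z ↦ −((H_{[0,n]} − z·I)⁻¹)_{0,0} converges, as n → ∞, locally uniformly on the open set {z ∈ ℂ : Im z > 0} \ spectrum(H), to the function z ↦ −⟨e_0 | (H − z)⁻¹ e_0⟩. -/
open MeasureTheory Complex Filter

/-- The (n+1)×(n+1) truncation H_{[0,n]} of the non-symmetric Jacobi matrix. -/
noncomputable def JacobiH0 (a b : ℕ → ℝ) (n : ℕ) : Matrix (Fin (n + 1)) (Fin (n + 1)) ℂ :=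
  Matrix.of fun i j =>
    if (i : ℕ) = (j : ℕ) then (a i : ℂ)
    else if (i : ℕ) + 1 = (j : ℕ) then (if (i : ℕ) = 0 then -(b 0 : ℂ) else (b (i : ℕ) : ℂ))
    else if (j : ℕ) + 1 = (i : ℕ) then (b (j : ℕ) : ℂ)
    else 0

/-- The n×n truncation H_{[1,n]} of the symmetric Jacobi matrix (entries shifted by one). -/
noncomputable def JacobiH1 (a b : ℕ → ℝ) (n : ℕ) : Matrix (Fin n) (Fin n) ℂ :=
  Matrix.of fun i j =>
    if (i : ℕ) = (j : ℕ) then (a ((i : ℕ) + 1) : ℂ)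
    else if (i : ℕ) + 1 = (j : ℕ) then (b ((i : ℕ) + 1) : ℂ)
    else if (j : ℕ) + 1 = (i : ℕ) then (b ((j : ℕ) + 1) : ℂ)
    else 0

/-- `lam` is an eigenvalue of nonpositive type of H_{[0,n]}. -/
def IsNPTev (a b : ℕ → ℝ) (n : ℕ) (lam : ℂ) : Prop :=
  0 ≤ lam.im ∧ ∃ f : Fin (n + 1) → ℂ, f ≠ 0 ∧ (JacobiH0 a b n).mulVec f = lam • f ∧
    -‖f 0‖ ^ 2 + ∑ j : Fin n, ‖f j.succ‖ ^ 2 ≤ 0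

/-- A row of `JacobiH0` acting on a sequence which vanishes just past the truncation. -/
lemma JacobiH0_sum_zero (a b : ℕ → ℝ) (n : ℕ) (w : ℕ → ℂ) (hw : w (n + 1) = 0) :
    ∑ j : Fin (n + 1), JacobiH0 a b n 0 j * w j = a 0 * w 0 - b 0 * w 1 := by
  rw [Fin.sum_univ_succ]
  rcases n with _ | n
  · simp_all [JacobiH0]
  · rw [Fin.sum_univ_succ, Finset.sum_eq_zero]
    · simp [JacobiH0]
      ring
    · intro j _
      simp [JacobiH0]

lemma JacobiH0_sum_succ (a b : ℕ → ℝ) (n k : ℕ) (hk : k + 1 < n + 1) (w : ℕ → ℂ)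
    (hw : w (n + 1) = 0) :
    ∑ j : Fin (n + 1), JacobiH0 a b n ⟨k + 1, hk⟩ j * w j
      = b k * w k + a (k + 1) * w (k + 1) + b (k + 1) * w (k + 2) := by
  have hterm : ∀ j : Fin (n + 1), JacobiH0 a b n ⟨k + 1, hk⟩ j * w j
      = (fun m : ℕ => (if m = k then (b k : ℂ) * w k else 0)
        + (if m = k + 1 then (a (k + 1) : ℂ) * w (k + 1) else 0)
        + (if m = k + 2 then (b (k + 1) : ℂ) * w (k + 2) else 0)) j := by
    intro j
    simp only [JacobiH0, Matrix.of_apply]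
    rcases lt_trichotomy (j : ℕ) (k + 1) with h | h | h
    · rcases eq_or_ne (j : ℕ) k with h' | h'
      · have : k + 1 + 1 ≠ k := by omega
        simp [h', this]
      · rw [if_neg (by omega), if_neg (by omega), if_neg (by omega), if_neg h',
          if_neg (by omega), if_neg (by omega)]
        simp
    · simp [h]
    · rcases eq_or_ne (j : ℕ) (k + 2) with h' | h'
      · simp [h']
      · rw [if_neg (by omega), if_neg (by omega), if_neg (by omega), if_neg (by omega),
          if_neg (by omega), if_neg h']
        simp
  rw [Finset.sum_congr rfl fun j _ => hterm j, Fin.sum_univ_eq_sum_range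
    (fun m : ℕ => (if m = k then (b k : ℂ) * w k else 0)
        + (if m = k + 1 then (a (k + 1) : ℂ) * w (k + 1) else 0)
        + (if m = k + 2 then (b (k + 1) : ℂ) * w (k + 2) else 0)),
    Finset.sum_add_distrib, Finset.sum_add_distrib, Finset.sum_ite_eq', Finset.sum_ite_eq',
    Finset.sum_ite_eq', if_pos (by simp; omega), if_pos (by simpa using hk)]
  split_ifs with h
  · rfl
  · have : k + 1 = n := by simp at h; omega
    subst this
    simp [hw]

/-- `V` solves the first `n + 1` equations of `(H - z) V = s • e₀`. -/
def SolvesUpTo (a b : ℕ → ℝ) (z s : ℂ) (n : ℕ) (V : ℕ → ℂ) : Prop :=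
  a 0 * V 0 - b 0 * V 1 - z * V 0 = s ∧
    ∀ k < n, b k * V k + a (k + 1) * V (k + 1) + b (k + 1) * V (k + 2) - z * V (k + 1) = 0

lemma exists_solvesUpTo_of_mulVec (a b : ℕ → ℝ) (z s : ℂ) (n : ℕ) (v : Fin (n + 1) → ℂ)
    (hv : (JacobiH0 a b n - z • 1).mulVec v = Pi.single 0 s) :
    ∃ V : ℕ → ℂ, (∀ j : Fin (n + 1), V j = v j) ∧ V (n + 1) = 0 ∧ SolvesUpTo a b z s n V := by
  let V : ℕ → ℂ := fun k => if h : k < n + 1 then v ⟨k, h⟩ else 0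
  have hVv : ∀ j : Fin (n + 1), V j = v j := fun j => dif_pos j.2
  have hV : V (n + 1) = 0 := by simp [V]
  have hrow : ∀ i : Fin (n + 1), ∑ j : Fin (n + 1), JacobiH0 a b n i j * V j - z * V i
      = (Pi.single 0 s : Fin (n + 1) → ℂ) i := by
    intro i
    rw [← hv]
    simp only [Matrix.sub_mulVec, Matrix.smul_mulVec, Matrix.one_mulVec, hVv]
    simp [Matrix.mulVec, dotProduct]
  refine ⟨V, hVv, hV, ?_, fun k hk => ?_⟩
  · have := hrow 0
    rw [JacobiH0_sum_zero a b n V hV] at this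
    simpa using this
  · have := hrow ⟨k + 1, by omega⟩
    rw [JacobiH0_sum_succ a b n k _ V hV] at this
    simpa [Pi.single_apply, Fin.ext_iff] using this

/-- Constancy of the Wronskian of two solutions. -/
lemma SolvesUpTo.wronskian {a b : ℕ → ℝ} {z s : ℂ} {n : ℕ} {V u : ℕ → ℂ}
    (hV : SolvesUpTo a b z s n V) (hu : SolvesUpTo a b z 1 n u) (hn : V (n + 1) = 0) :
    V 0 - s * u 0 = -(b n * u (n + 1) * V n) := by
  have h : ∀ k ≤ n, b k * (u (k + 1) * V k - u k * V (k + 1)) = s * u 0 - V 0 := by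
    intro k
    induction k with
    | zero => intro _; linear_combination u 0 * hV.1 - V 0 * hu.1
    | succ k ih =>
      intro hk
      linear_combination ih (by omega) + V (k + 1) * hu.2 k hk - u (k + 1) * hV.2 k hk
  have := h n le_rfl
  rw [hn] at this
  linear_combination this

/-- The energy estimate coming from the indefinite symmetry of the operator. -/
lemma SolvesUpTo.energy {a b : ℕ → ℝ} {z s : ℂ} {n : ℕ} {V : ℕ → ℂ}
    (hV : SolvesUpTo a b z s n V) (hz : 0 ≤ z.im) (hn0 : n ≠ 0) (hn : V (n + 1) = 0) :
    z.im * ‖V n‖ ^ 2 ≤ z.im * ‖V 0‖ ^ 2 + ‖s‖ * ‖V 0‖ := by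
  let E : ℕ → ℝ := fun k => b k * ((V k).re * (V (k + 1)).im - (V k).im * (V (k + 1)).re)
  have hE0 : E 0 = -(z.im * ‖V 0‖ ^ 2) - (s * starRingEnd ℂ (V 0)).im := by
    have hre := congrArg Complex.re hV.1
    have him := congrArg Complex.im hV.1
    simp at hre him
    simp only [E, ← Complex.normSq_eq_norm_sq, Complex.normSq_apply, Complex.mul_im,
      Complex.conj_re, Complex.conj_im]
    linear_combination (V 0).im * hre - (V 0).re * him
  have hstep : ∀ k < n, E (k + 1) = E k + z.im * ‖V (k + 1)‖ ^ 2 := by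
    intro k hk
    have hre := congrArg Complex.re (hV.2 k hk)
    have him := congrArg Complex.im (hV.2 k hk)
    simp at hre him
    simp only [E, ← Complex.normSq_eq_norm_sq, Complex.normSq_apply]
    linear_combination (V (k + 1)).re * him - (V (k + 1)).im * hre
  have hmono : ∀ k ≤ n, E 0 ≤ E k := by
    intro k
    induction k with
    | zero => intro _; exact le_rfl
    | succ k ih =>
      intro hk
      rw [hstep k hk]
      have := ih (by omega)
      have : 0 ≤ z.im * ‖V (k + 1)‖ ^ 2 := by positivity
      linarith
  obtain ⟨m, rfl⟩ := Nat.exists_eq_succ_of_ne_zero hn0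
  have h1 := hstep m (by omega)
  have h2 := hmono m (by omega)
  have h3 : E (m + 1) = 0 := by simp only [E, Nat.succ_eq_add_one] at hn ⊢; simp [hn]
  have h4 : (s * starRingEnd ℂ (V 0)).im ≤ ‖s‖ * ‖V 0‖ := by
    have := (abs_le.1 (Complex.abs_im_le_norm (s * starRingEnd ℂ (V 0)))).2
    rwa [norm_mul, RCLike.norm_conj] at this
  simp only [Nat.succ_eq_add_one]
  linarith

lemma SolvesUpTo.eq_zero {a b : ℕ → ℝ} (hb : ∀ j, 0 < b j) {z : ℂ} {n : ℕ} {V : ℕ → ℂ}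
    (hV : SolvesUpTo a b z 0 n V) (h0 : V 0 = 0) : ∀ k ≤ n, V k = 0 := by
  have hb' : ∀ j, (b j : ℂ) ≠ 0 := fun j => by exact_mod_cast (hb j).ne'
  have h : ∀ k ≤ n, V k = 0 ∧ V (k + 1) = 0 := by
    intro k
    induction k with
    | zero =>
      have := hV.1
      simp [h0, hb'] at this
      exact fun _ => ⟨h0, this⟩
    | succ k ih =>
      intro hk
      obtain ⟨h1, h2⟩ := ih (by omega)
      have := hV.2 k hk
      simp [h1, h2, hb'] at this
      exact ⟨h2, this⟩
  exact fun k hk => (h k hk).1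

/-- A quadratic estimate. -/
lemma le_of_energy_bound {t U c y x : ℝ} (ht : 0 < t) (hU : 0 ≤ U) (hc : 0 ≤ c) (hc2 : c ≤ 1 / 2)
    (hx0 : 0 ≤ x) (hy : 0 ≤ y) (hx : x ≤ U + c * y) (h : t * y ^ 2 ≤ t * x ^ 2 + x) :
    y ≤ 8 * U ^ 2 + 4 * U / t + 1 / t ^ 2 + 1 := by
  have hx1 : x ≤ U + y / 2 := by nlinarith
  have hx2 : x ^ 2 ≤ 2 * U ^ 2 + y ^ 2 / 2 := by nlinarith [sq_nonneg (U - y / 2)]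
  have h1 : y ^ 2 ≤ 4 * U ^ 2 + (2 * U + y) / t := by
    have : t * y ^ 2 ≤ t * (2 * U ^ 2 + y ^ 2 / 2) + (U + y / 2) := by nlinarith
    have h2 : t * y ^ 2 ≤ t * (4 * U ^ 2) + (2 * U + y) := by linarith
    calc y ^ 2 = t * y ^ 2 / t := by field_simp
      _ ≤ (t * (4 * U ^ 2) + (2 * U + y)) / t := by gcongr
      _ = _ := by field_simp
  have h3 : y ^ 2 ≤ 8 * U ^ 2 + 4 * U / t + 1 / t ^ 2 := by
    have h4 := sq_nonneg (y - 1 / t)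
    have e1 : (2 * U + y) / t = 2 * U / t + y * (1 / t) := by ring
    have e2 : 4 * U / t = 2 * (2 * U / t) := by ring
    have e3 : 1 / t ^ 2 = (1 / t) ^ 2 := by ring
    rw [e1] at h1
    rw [e2, e3]
    nlinarith
  nlinarith [sq_nonneg (y - 1 / 2)]

/-- Distance from the corner entry of the truncated resolvent to that of the full one. -/
lemma norm_JacobiH0_inv_sub_le {a b : ℕ → ℝ} (hb : ∀ j, 0 < b j) {z : ℂ} (hz : 0 < z.im) {n : ℕ}
    (hn : n ≠ 0) {u : ℕ → ℂ} (hu : SolvesUpTo a b z 1 n u) (hc : ‖b n * u (n + 1)‖ ≤ 1 / 2) :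
    ‖(JacobiH0 a b n - z • 1)⁻¹ 0 0 - u 0‖ ≤
      ‖b n * u (n + 1)‖ * (8 * ‖u 0‖ ^ 2 + 4 * ‖u 0‖ / z.im + 1 / z.im ^ 2 + 1) := by
  have hinj : Function.Injective (JacobiH0 a b n - z • 1).mulVec := by
    rw [← Matrix.coe_mulVecLin, ← LinearMap.ker_eq_bot, LinearMap.ker_eq_bot']
    intro v hv
    obtain ⟨V, hVv, hVn, hV⟩ := exists_solvesUpTo_of_mulVec a b z 0 n v
      (by rw [Pi.single_zero]; exact hv)
    have hw := hV.wronskian hu hVn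
    have he := hV.energy hz.le hn hVn
    have hw' : ‖V 0‖ = ‖b n * u (n + 1)‖ * ‖V n‖ := by
      rw [← norm_mul, ← norm_neg (_ * V n), ← hw]; simp
    have h0 : V 0 = 0 := by
      have h1 : ‖V n‖ ^ 2 ≤ ‖V 0‖ ^ 2 := by
        simp only [norm_zero, zero_mul, add_zero] at he
        exact le_of_mul_le_mul_left he hz
      have h2 : ‖V n‖ ≤ ‖V 0‖ := (sq_le_sq₀ (norm_nonneg _) (norm_nonneg _)).1 h1
      rw [← norm_le_zero_iff]
      nlinarith [norm_nonneg (V n)]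
    ext j
    rw [← hVv j, hV.eq_zero hb h0 j (by omega)]
    rfl
  have hunit := Matrix.mulVec_injective_iff_isUnit.1 hinj
  have hdet := (Matrix.isUnit_iff_isUnit_det _).1 hunit
  obtain ⟨V, hVv, hVn, hV⟩ := exists_solvesUpTo_of_mulVec a b z 1 n
    ((JacobiH0 a b n - z • 1)⁻¹.mulVec (Pi.single 0 1))
    (by rw [Matrix.mulVec_mulVec, Matrix.mul_nonsing_inv _ hdet, Matrix.one_mulVec])
  have hV0 : V 0 = (JacobiH0 a b n - z • 1)⁻¹ 0 0 := by
    have := hVv 0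
    simpa using this
  have hw := hV.wronskian hu hVn
  rw [one_mul] at hw
  have he := hV.energy hz.le hn hVn
  rw [norm_one, one_mul] at he
  have hx : ‖V 0‖ ≤ ‖u 0‖ + ‖b n * u (n + 1)‖ * ‖V n‖ := by
    have : V 0 = u 0 - b n * u (n + 1) * V n := by linear_combination hw
    rw [this, ← norm_mul]
    exact norm_sub_le _ _
  rw [← hV0, hw, norm_neg, norm_mul _ (V n)]
  gcongr
  exact le_of_energy_bound hz (norm_nonneg _) (norm_nonneg _) hc (norm_nonneg _) (norm_nonneg _)
    hx he

/-- Proposition 3: locally uniform convergence of the truncated m-functions. -/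
theorem stmt_7
    (a b : ℕ → ℝ) (ha : ∃ C : ℝ, ∀ j, |a j| ≤ C) (hbbd : ∃ C : ℝ, ∀ j, |b j| ≤ C)
    (hb : ∀ j, 0 < b j)
    (H : lp (fun _ : ℕ => ℂ) 2 →L[ℂ] lp (fun _ : ℕ => ℂ) 2)
    (hH0 : ∀ x : lp (fun _ : ℕ => ℂ) 2,
      (H x : ∀ _ : ℕ, ℂ) 0 = (a 0 : ℂ) * (x : ∀ _ : ℕ, ℂ) 0 - (b 0 : ℂ) * (x : ∀ _ : ℕ, ℂ) 1)
    (hHk : ∀ x : lp (fun _ : ℕ => ℂ) 2, ∀ k : ℕ,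
      (H x : ∀ _ : ℕ, ℂ) (k + 1) = (b k : ℂ) * (x : ∀ _ : ℕ, ℂ) k
        + (a (k + 1) : ℂ) * (x : ∀ _ : ℕ, ℂ) (k + 1) + (b (k + 1) : ℂ) * (x : ∀ _ : ℕ, ℂ) (k + 2))
    :
    TendstoLocallyUniformlyOn
      (fun (n : ℕ) (z : ℂ) => -(((JacobiH0 a b n - z • 1)⁻¹) 0 0))
      (fun z : ℂ =>
        -(@inner ℂ _ _ (lp.single 2 0 (1 : ℂ)) (Ring.inverse (H - z • 1) (lp.single 2 0 (1 : ℂ)))))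
      atTop ({z : ℂ | 0 < z.im} \ spectrum ℂ H) := by
  obtain ⟨B, hB⟩ := hbbd
  rw [tendstoLocallyUniformlyOn_iff_filter]
  rintro z₀ ⟨hz₀, hspec⟩
  set s : Set ℂ := {z : ℂ | 0 < z.im} \ spectrum ℂ H with hs
  set e : lp (fun _ : ℕ => ℂ) 2 := lp.single 2 0 (1 : ℂ) with he
  let u : ℂ → lp (fun _ : ℕ => ℂ) 2 := fun z => Ring.inverse (H - z • 1) e
  have hunit : ∀ z, z ∉ spectrum ℂ H → IsUnit (H - z • 1) := by
    intro z hz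
    rw [spectrum.notMem_iff, Algebra.algebraMap_eq_smul_one] at hz
    rw [← neg_sub]
    exact hz.neg
  have hsolve : ∀ z, z ∉ spectrum ℂ H → ∀ n, SolvesUpTo a b z 1 n (u z) := by
    intro z hz n
    have h1 : H (u z) - z • u z = e := by
      have := congrArg (fun T : lp (fun _ : ℕ => ℂ) 2 →L[ℂ] lp (fun _ : ℕ => ℂ) 2 => T e)
        (Ring.mul_inverse_cancel _ (hunit z hz))
      simpa [u] using this
    have h2 : ∀ k, (H (u z) : ∀ _ : ℕ, ℂ) k - z * u z k = e k := by
      intro k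
      rw [← h1]
      rfl
    refine ⟨?_, fun k _ => ?_⟩
    · rw [← hH0, h2]
      simp [he]
    · rw [← hHk, h2]
      simp [he, lp.single_apply]
  have hcont : ContinuousAt u z₀ := by
    obtain ⟨x, hx⟩ := hunit z₀ hspec
    have h1 : ContinuousAt (fun z : ℂ => Ring.inverse (H - z • 1)) z₀ :=
      ContinuousAt.comp' (g := Ring.inverse) (hx ▸ NormedRing.inverse_continuousAt x) (by fun_prop)
    exact h1.clm_apply continuousAt_const
  have hu : Tendsto u (nhdsWithin z₀ s) (nhds (u z₀)) := hcont.tendsto.mono_left nhdsWithin_le_nhds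
  have hcoord : ∀ (x : lp (fun _ : ℕ => ℂ) 2) k, ‖x k‖ ≤ ‖x‖ :=
    fun x k => lp.norm_apply_le_norm two_ne_zero x k
  have hB0 : 0 ≤ B := (abs_nonneg _).trans (hB 0)
  let c : ℕ × ℂ → ℝ := fun p => B * (‖u z₀ (p.1 + 1)‖ + ‖u p.2 - u z₀‖)
  have hc : Tendsto c (atTop ×ˢ nhdsWithin z₀ s) (nhds 0) := by
    have h1 : Tendsto (fun n : ℕ => ‖u z₀ (n + 1)‖) atTop (nhds 0) := by
      have h2 : Summable fun k => ‖u z₀ k‖ ^ (2 : ℝ) := by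
        simpa using (lp.memℓp (u z₀)).summable (by norm_num)
      have h3 := ((tendsto_add_atTop_iff_nat 1).2 h2.tendsto_atTop_zero).sqrt
      simpa using h3
    have h4 : Tendsto (fun z => ‖u z - u z₀‖) (nhdsWithin z₀ s) (nhds 0) :=
      tendsto_iff_norm_sub_tendsto_zero.1 hu
    simpa using ((h1.comp tendsto_fst).add (h4.comp tendsto_snd)).const_mul B
  have hcle : ∀ n z, ‖(b n : ℂ) * u z (n + 1)‖ ≤ c (n, z) := by
    intro n z
    rw [norm_mul, Complex.norm_real, Real.norm_eq_abs]
    refine mul_le_mul (hB n) ?_ (norm_nonneg _) hB0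
    have h1 := norm_add_le (u z₀ (n + 1)) ((u z - u z₀) (n + 1))
    have h2 := hcoord (u z - u z₀) (n + 1)
    have h3 : u z₀ (n + 1) + (u z - u z₀) (n + 1) = u z (n + 1) := by simp
    rw [h3] at h1
    linarith
  let M : ℂ → ℝ := fun z => 8 * ‖u z‖ ^ 2 + 4 * ‖u z‖ / z.im + 1 / z.im ^ 2 + 1
  have hM : Tendsto M (nhdsWithin z₀ s) (nhds (M z₀)) := by
    have him : Tendsto Complex.im (nhdsWithin z₀ s) (nhds z₀.im) :=
      Complex.continuous_im.continuousAt.tendsto.mono_left nhdsWithin_le_nhds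
    have hz : z₀.im ≠ 0 := ne_of_gt hz₀
    exact ((((hu.norm.pow 2).const_mul 8).add ((hu.norm.const_mul 4).div him hz)).add
      (tendsto_const_nhds.div (him.pow 2) (pow_ne_zero 2 hz))).add tendsto_const_nhds
  have hprod : Tendsto (fun p : ℕ × ℂ => c p * M p.2) (atTop ×ˢ nhdsWithin z₀ s) (nhds 0) := by
    simpa using hc.mul (hM.comp tendsto_snd)
  rw [Metric.tendstoUniformlyOnFilter_iff]
  intro ε hε
  have hmem : ∀ᶠ p : ℕ × ℂ in atTop ×ˢ nhdsWithin z₀ s, p.2 ∈ s :=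
    tendsto_snd.eventually self_mem_nhdsWithin
  have hne : ∀ᶠ p : ℕ × ℂ in atTop ×ˢ nhdsWithin z₀ s, p.1 ≠ 0 :=
    tendsto_fst.eventually (eventually_ne_atTop 0)
  filter_upwards [hmem, hne, hc.eventually_le_const (by norm_num : (0 : ℝ) < 1 / 2),
    hprod.eventually_lt_const hε]
  rintro ⟨n, z⟩ ⟨hz, hzs⟩ hn hcn hlt
  have hz' : 0 < z.im := hz
  have hmain := norm_JacobiH0_inv_sub_le hb hz' hn (hsolve z hzs n) ((hcle n z).trans hcn)
  have hinner : inner ℂ e (Ring.inverse (H - z • 1) e) = u z 0 := by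
    simp [he, u, lp.inner_single_left]
  rw [hinner, dist_neg_neg, dist_comm, dist_eq_norm]
  refine (hmain.trans ?_).trans_lt hlt
  have h0 := hcoord (u z) 0
  refine mul_le_mul (hcle n z) ?_ (by positivity) ((norm_nonneg _).trans (hcle n z))
  simp only [M]
  gcongr
end
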